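/- arXiv:math/0508606 — 2 statements merged into one kernel-verified Lean document; each statement's English description precedes it below -/
import Mathlib

section
/- The standard normal hazard rate ρ(x) = φ(x)/Φ̄(x) is a strictly increasing function of x on ℝ. -/
/-- Standard normal density. -/
noncomputable def stdPhi (x : ℝ) : ℝ := Real.exp (-x ^ 2 / 2) / Real.sqrt (2 * Real.pi)

/-- Standard normal upper-tail probability. -/
noncomputable def phiBar (x : ℝ) : ℝ := ∫ t in Set.Ioi x, stdPhi t

/-- Standard normal hazard rate. -/
noncomputable def rho (x : ℝ) : ℝ := stdPhi x / phiBar x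

/-- The difference r(x) = ρ(x) − x. -/
noncomputable def rFun (x : ℝ) : ℝ := rho x - x

/-- Ψ(x) = −log Φ̄(x). -/
noncomputable def Psi (x : ℝ) : ℝ := -Real.log (phiBar x)

theorem stdPhi_pos (x : ℝ) : 0 < stdPhi x := by
  unfold stdPhi
  positivity

theorem integrable_stdPhi : MeasureTheory.Integrable stdPhi := by
  refine ((integrable_exp_neg_mul_sq (b := 1 / 2) (by norm_num)).div_const
    (Real.sqrt (2 * Real.pi))).congr (.of_forall fun x => ?_)
  simp only [stdPhi]
  ring_nf

theorem phiBar_eq_integral_shift (x : ℝ) :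
    phiBar x = ∫ s in Set.Ioi (0 : ℝ), stdPhi (x + s) := by
  have h := (MeasureTheory.measurePreserving_add_left MeasureTheory.volume x).setIntegral_preimage_emb
    (measurableEmbedding_addLeft x) stdPhi (Set.Ioi x)
  simpa [phiBar] using h.symm

theorem MeasureTheory.setIntegral_Ioi_pos {f : ℝ → ℝ} {a : ℝ} (hf : ∀ t ∈ Set.Ioi a, 0 < f t)
    (hfi : IntegrableOn f (Set.Ioi a)) : 0 < ∫ t in Set.Ioi a, f t := by
  rw [setIntegral_pos_iff_support_of_nonneg_ae
    (ae_restrict_of_forall_mem measurableSet_Ioi fun t ht => (hf t ht).le) hfi,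
    Set.inter_eq_right.mpr fun t ht => Function.mem_support.mpr (hf t ht).ne']
  simp

theorem phiBar_pos (x : ℝ) : 0 < phiBar x :=
  MeasureTheory.setIntegral_Ioi_pos (fun t _ => stdPhi_pos t) integrable_stdPhi.integrableOn

/-- Strict log-concavity of the normal density, in the form of a comparison of translates. -/
theorem stdPhi_mul_stdPhi_add_lt {x y s : ℝ} (hxy : x < y) (hs : 0 < s) :
    stdPhi x * stdPhi (y + s) < stdPhi y * stdPhi (x + s) := by
  simp only [stdPhi, div_mul_div_comm, ← Real.exp_add]
  gcongr ?_ / _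
  exact Real.exp_lt_exp.mpr (by nlinarith [mul_pos (sub_pos.mpr hxy) hs])

theorem rho_strictMono : StrictMono rho := by
  intro x y hxy
  rw [rho, rho, div_lt_div_iff₀ (phiBar_pos x) (phiBar_pos y), ← sub_pos,
    phiBar_eq_integral_shift x, phiBar_eq_integral_shift y]
  have hi (c z : ℝ) : MeasureTheory.Integrable (fun s => c * stdPhi (z + s))
      (MeasureTheory.volume.restrict (Set.Ioi 0)) :=
    ((integrable_stdPhi.comp_add_left z).const_mul c).integrableOn
  rw [← MeasureTheory.integral_const_mul, ← MeasureTheory.integral_const_mul,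
    ← MeasureTheory.integral_sub (hi _ _) (hi _ _)]
  exact MeasureTheory.setIntegral_Ioi_pos
    (fun s hs => sub_pos.mpr (stdPhi_mul_stdPhi_add_lt hxy hs)) ((hi _ _).sub (hi _ _))
end

section
/- For every real ε with 0 ≤ ε < 1 and every real s with 0 < s < 1, one has (1/2)(1+ε)log(1−s) + (1/2)(1−ε)log(1+s) ≤ −εs − s²/2. (That is, the function h(s) = (1/2)(1+ε)log(1−s) + (1/2)(1−ε)log(1+s) satisfies h(s) ≤ ε²/2 − (s+ε)²/2 on (0,1).) -/
theorem two_mul_le_log_one_add_sub_log_one_sub {s : ℝ} (hs0 : 0 ≤ s) (hs1 : s < 1) :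
    2 * s ≤ Real.log (1 + s) - Real.log (1 - s) := by
  have h := Real.hasSum_log_sub_log_of_abs_lt_one (x := s) (by rwa [abs_of_nonneg hs0])
  simpa using le_hasSum h 0 fun k _ => by positivity

theorem log_one_sub_add_log_one_add_le {s : ℝ} (hs0 : -1 < s) (hs1 : s < 1) :
    Real.log (1 - s) + Real.log (1 + s) ≤ -s ^ 2 := by
  have h1 : 0 < 1 - s := by linarith
  have h2 : 0 < 1 + s := by linarith
  rw [← Real.log_mul h1.ne' h2.ne']
  linarith [Real.log_le_sub_one_of_pos (mul_pos h1 h2)]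

theorem h_upper_bound (ε s : ℝ) (hε0 : 0 ≤ ε) (hε1 : ε < 1) (hs0 : 0 < s) (hs1 : s < 1) :
    (1 / 2) * (1 + ε) * Real.log (1 - s) + (1 / 2) * (1 - ε) * Real.log (1 + s)
      ≤ -(ε * s) - s ^ 2 / 2 := by
  have h1 := mul_le_mul_of_nonneg_left
    (two_mul_le_log_one_add_sub_log_one_sub hs0.le hs1) hε0
  have h2 := log_one_sub_add_log_one_add_le (by linarith) hs1
  linarith
end
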